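/- The proof system K4^{∇•} is strongly complete with respect to the class of transitive Kripke frames: every K4^{∇•}-consistent set Γ of L(∇,•)-formulas is satisfiable at some world of some transitive Kripke model. -/

import Mathlib

inductive Form : Type
  | atom : Nat → Form
  | neg : Form → Form
  | and : Form → Form → Form
  | nabla : Form → Form
  | bull : Form → Form

namespace Form
def imp (φ ψ : Form) : Form := neg (and φ (neg ψ))
def orf (φ ψ : Form) : Form := neg (and (neg φ) (neg ψ))
def ifff (φ ψ : Form) : Form := and (imp φ ψ) (imp ψ φ)
def delta (φ : Form) : Form := neg (nabla φ)
def circ (φ : Form) : Form := neg (bull φ)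
end Form

structure Model (W : Type) where
  R : W → W → Prop
  V : Nat → W → Prop

def sat {W : Type} (M : Model W) : W → Form → Prop
  | s, .atom n => M.V n s
  | s, .neg φ => ¬ sat M s φ
  | s, .and φ ψ => sat M s φ ∧ sat M s ψ
  | s, .nabla φ => ∃ t u, M.R s t ∧ M.R s u ∧ sat M t φ ∧ ¬ sat M u φ
  | s, .bull φ => sat M s φ ∧ ∃ t, M.R s t ∧ ¬ sat M t φ

/-- Boolean evaluation treating atoms, `∇φ` and `•φ` as propositional atoms;
used to express "instance of a propositional tautology". -/
def evalT (v : Form → Bool) : Form → Bool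
  | .neg φ => !(evalT v φ)
  | .and φ ψ => evalT v φ && evalT v ψ
  | φ => v φ

/-- `φ` is an instance of a propositional tautology. -/
def Taut (φ : Form) : Prop := ∀ v : Form → Bool, evalT v φ = true

/-- Derivability in the minimal system `K^{∇•}`. -/
inductive Prov : Form → Prop
  | a0 : ∀ φ, Taut φ → Prov φ
  | a1 : ∀ φ, Prov (Form.imp (.bull φ) φ)
  | a2 : ∀ φ, Prov (Form.ifff (.nabla φ) (.nabla (.neg φ)))
  | a3 : ∀ φ ψ, Prov (Form.imp (.and (.bull (Form.imp ψ φ)) φ) (.bull φ))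
  | a4 : ∀ φ ψ, Prov (Form.imp (.nabla (.and φ ψ)) (Form.orf (.nabla φ) (.nabla ψ)))
  | a5 : ∀ φ ψ, Prov (Form.imp (.bull (.and φ ψ)) (Form.orf (.bull φ) (.bull ψ)))
  | a6 : ∀ φ, Prov (Form.imp (.nabla φ) (Form.orf (.bull φ) (.bull (.neg φ))))
  | a7 : ∀ φ ψ χ, Prov (Form.imp (.and (.bull (Form.imp φ ψ)) (.bull (Form.imp (.neg φ) χ))) (.nabla φ))
  | r1 : ∀ φ, Prov φ → Prov (Form.delta φ)
  | r2 : ∀ φ, Prov φ → Prov (Form.circ φ)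
  | r3 : ∀ φ ψ, Prov (Form.ifff φ ψ) → Prov (Form.ifff (Form.delta φ) (Form.delta ψ))
  | r4 : ∀ φ ψ, Prov (Form.ifff φ ψ) → Prov (Form.ifff (Form.circ φ) (Form.circ ψ))
  | mp : ∀ φ ψ, Prov (Form.imp φ ψ) → Prov φ → Prov ψ

/-- Axiom A4-1: `Δφ → ΔΔφ`. -/
def ax41 (φ : Form) : Form := Form.imp (Form.delta φ) (Form.delta (Form.delta φ))

/-- Axiom A4-2: `Δφ → ∘(ψ → Δφ)`. -/
def ax42 (φ ψ : Form) : Form :=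
  Form.imp (Form.delta φ) (Form.circ (Form.imp ψ (Form.delta φ)))

/-- Axiom A4-3: `(•ψ₁ ∧ Δφ ∧ ∘(¬ψ₁→φ)) → Δ∘(¬ψ₂→φ)`. -/
def ax43 (φ ψ₁ ψ₂ : Form) : Form :=
  Form.imp
    (.and (.bull ψ₁) (.and (Form.delta φ) (Form.circ (Form.imp (.neg ψ₁) φ))))
    (Form.delta (Form.circ (Form.imp (.neg ψ₂) φ)))

/-- Axiom A4-4: `(•ψ₁ ∧ Δφ ∧ ∘(¬ψ₁→φ)) → ∘(¬ψ₁ → ∘(¬ψ₂→φ))`. -/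
def ax44 (φ ψ₁ ψ₂ : Form) : Form :=
  Form.imp
    (.and (.bull ψ₁) (.and (Form.delta φ) (Form.circ (Form.imp (.neg ψ₁) φ))))
    (Form.circ (Form.imp (.neg ψ₁) (Form.circ (Form.imp (.neg ψ₂) φ))))

/-- Derivability in the system `K4^{∇•}` = `K^{∇•}` + A4-1 + A4-2 + A4-3 + A4-4. -/
inductive Prov4 : Form → Prop
  | a0 : ∀ φ, Taut φ → Prov4 φ
  | a1 : ∀ φ, Prov4 (Form.imp (.bull φ) φ)
  | a2 : ∀ φ, Prov4 (Form.ifff (.nabla φ) (.nabla (.neg φ)))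
  | a3 : ∀ φ ψ, Prov4 (Form.imp (.and (.bull (Form.imp ψ φ)) φ) (.bull φ))
  | a4 : ∀ φ ψ, Prov4 (Form.imp (.nabla (.and φ ψ)) (Form.orf (.nabla φ) (.nabla ψ)))
  | a5 : ∀ φ ψ, Prov4 (Form.imp (.bull (.and φ ψ)) (Form.orf (.bull φ) (.bull ψ)))
  | a6 : ∀ φ, Prov4 (Form.imp (.nabla φ) (Form.orf (.bull φ) (.bull (.neg φ))))
  | a7 : ∀ φ ψ χ, Prov4 (Form.imp (.and (.bull (Form.imp φ ψ)) (.bull (Form.imp (.neg φ) χ))) (.nabla φ))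
  | a41 : ∀ φ, Prov4 (ax41 φ)
  | a42 : ∀ φ ψ, Prov4 (ax42 φ ψ)
  | a43 : ∀ φ ψ₁ ψ₂, Prov4 (ax43 φ ψ₁ ψ₂)
  | a44 : ∀ φ ψ₁ ψ₂, Prov4 (ax44 φ ψ₁ ψ₂)
  | r1 : ∀ φ, Prov4 φ → Prov4 (Form.delta φ)
  | r2 : ∀ φ, Prov4 φ → Prov4 (Form.circ φ)
  | r3 : ∀ φ ψ, Prov4 (Form.ifff φ ψ) → Prov4 (Form.ifff (Form.delta φ) (Form.delta ψ))
  | r4 : ∀ φ ψ, Prov4 (Form.ifff φ ψ) → Prov4 (Form.ifff (Form.circ φ) (Form.circ ψ))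
  | mp : ∀ φ ψ, Prov4 (Form.imp φ ψ) → Prov4 φ → Prov4 ψ

/-- `bigAnd [χ₁, …, χₙ] = χ₁ ∧ ⋯ ∧ χₙ` (for nonempty lists). -/
def bigAnd : List Form → Form
  | [] => Form.neg (Form.and (Form.atom 0) (Form.neg (Form.atom 0)))
  | [φ] => φ
  | φ :: ψ :: rest => Form.and φ (bigAnd (ψ :: rest))

/-- `Γ` is `K4^{∇•}`-consistent: no finite subset `{φ₁,…,φₙ}` (n ≥ 1) of `Γ` has
`¬(φ₁ ∧ ⋯ ∧ φₙ)` derivable in `K4^{∇•}`. -/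
def Consistent4 (Γ : Set Form) : Prop :=
  ¬ ∃ L : List Form, L ≠ [] ∧ (∀ φ ∈ L, φ ∈ Γ) ∧ Prov4 (.neg (bigAnd L))

namespace K4P
open Form

def bot : Form := .and (.atom 0) (.neg (.atom 0))

inductive Der (Γ : Set Form) : Form → Prop
  | hyp : ∀ φ, φ ∈ Γ → Der Γ φ
  | prov : ∀ φ, Prov4 φ → Der Γ φ
  | mp : ∀ φ ψ, Der Γ (imp φ ψ) → Der Γ φ → Der Γ ψ

theorem taut1 (φ ψ : Form) (h : ∀ v, evalT v φ = true → evalT v ψ = true) (hp : Prov4 φ) :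
    Prov4 ψ := by
  refine .mp φ ψ (.a0 _ ?_) hp
  intro v
  have := h v
  simp only [imp, evalT]
  cases h1 : evalT v φ <;> cases h2 : evalT v ψ <;> simp_all

theorem taut2 (φ χ ψ : Form) (h : ∀ v, evalT v φ = true → evalT v χ = true → evalT v ψ = true)
    (hp : Prov4 φ) (hq : Prov4 χ) : Prov4 ψ := by
  refine .mp χ ψ (taut1 φ _ ?_ hp) hq
  intro v
  have := h v
  simp only [imp, evalT]
  cases h1 : evalT v φ <;> cases h2 : evalT v ψ <;> cases h3 : evalT v χ <;> simp_all

theorem Der.taut1 {Γ} (φ ψ : Form) (h : ∀ v, evalT v φ = true → evalT v ψ = true)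
    (hp : Der Γ φ) : Der Γ ψ := by
  refine .mp φ ψ (.prov _ (.a0 _ ?_)) hp
  intro v
  have := h v
  simp only [imp, evalT]
  cases h1 : evalT v φ <;> cases h2 : evalT v ψ <;> simp_all

theorem Der.taut2 {Γ} (φ χ ψ : Form)
    (h : ∀ v, evalT v φ = true → evalT v χ = true → evalT v ψ = true)
    (hp : Der Γ φ) (hq : Der Γ χ) : Der Γ ψ := by
  refine .mp χ ψ (Der.taut1 φ _ ?_ hp) hq
  intro v
  have := h v
  simp only [imp, evalT]
  cases h1 : evalT v φ <;> cases h2 : evalT v ψ <;> cases h3 : evalT v χ <;> simp_all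

theorem eval_imp (v) (φ ψ : Form) : evalT v (imp φ ψ) = (!evalT v φ || evalT v ψ) := by
  simp [imp, evalT]

theorem ded {Γ : Set Form} {φ ψ : Form} (h : Der (insert φ Γ) ψ) : Der Γ (imp φ ψ) := by
  induction h with
  | hyp χ hχ =>
    rcases hχ with rfl | hχ
    · exact .prov _ (.a0 _ (fun v => by simp [eval_imp]))
    · exact Der.taut1 χ _ (fun v => by simp +contextual [eval_imp]) (.hyp _ hχ)
  | prov χ hχ =>
    exact Der.taut1 χ _ (fun v => by simp +contextual [eval_imp]) (.prov _ hχ)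
  | mp a b _ _ h1 h2 =>
    refine Der.taut2 _ _ _ (fun v => ?_) h1 h2
    simp only [eval_imp]
    cases evalT v φ <;> cases evalT v a <;> cases evalT v b <;> simp

theorem Der.mono {Γ Δ : Set Form} (h : Γ ⊆ Δ) {φ} (d : Der Γ φ) : Der Δ φ := by
  induction d with
  | hyp χ hχ => exact .hyp _ (h hχ)
  | prov χ hχ => exact .prov _ hχ
  | mp a b _ _ h1 h2 => exact .mp _ _ h1 h2

theorem der_chain {c : Set (Set Form)} (hc : IsChain (· ⊆ ·) c) (hne : c.Nonempty) {φ}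
    (d : Der (⋃₀ c) φ) : ∃ t ∈ c, Der t φ := by
  induction d with
  | hyp χ hχ => obtain ⟨t, ht, h⟩ := hχ; exact ⟨t, ht, .hyp _ h⟩
  | prov χ hχ => obtain ⟨t, ht⟩ := hne; exact ⟨t, ht, .prov _ hχ⟩
  | mp a b _ _ h1 h2 =>
    obtain ⟨t, ht, h1⟩ := h1
    obtain ⟨u, hu, h2⟩ := h2
    rcases hc.total ht hu with h | h
    · exact ⟨u, hu, .mp _ _ (h1.mono h) h2⟩
    · exact ⟨t, ht, .mp _ _ h1 (h2.mono h)⟩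

structure MCS (s : Set Form) : Prop where
  con : ¬ Der s bot
  max : ∀ φ, φ ∈ s ∨ .neg φ ∈ s

theorem lind (Γ : Set Form) (h : ¬ Der Γ bot) : ∃ t, Γ ⊆ t ∧ MCS t := by
  obtain ⟨t, hΓ, ht⟩ := zorn_subset_nonempty {t | ¬ Der t bot} (by
    intro c hc1 hc2 hne
    refine ⟨⋃₀ c, ?_, fun s hs => Set.subset_sUnion_of_mem hs⟩
    intro d
    obtain ⟨t, ht, d⟩ := der_chain hc2 hne d
    exact hc1 ht d) Γ h
  refine ⟨t, hΓ, ht.prop, fun φ => ?_⟩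
  by_contra hcon
  push Not at hcon
  obtain ⟨h1, h2⟩ := hcon
  have key : ∀ ψ, ψ ∉ t → Der (insert ψ t) bot := by
    intro ψ hψ
    by_contra hd
    exact hψ (ht.le_of_ge hd (Set.subset_insert _ _) (Set.mem_insert _ _))
  refine ht.prop (Der.taut2 _ _ _ (fun v => ?_) (ded (key _ h1)) (ded (key _ h2)))
  simp only [eval_imp, bot, evalT]
  cases evalT v φ <;> simp

section
variable {s : Set Form} (m : MCS s)
include m
theorem MCS.neg_iff (φ) : .neg φ ∈ s ↔ φ ∉ s := by
  refine ⟨fun h1 h2 => m.con ?_, fun h => (m.max φ).resolve_left h⟩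
  refine Der.taut2 _ _ _ (fun v => ?_) (.hyp _ h1) (.hyp _ h2)
  simp only [evalT]
  cases evalT v φ <;> simp
theorem MCS.der {φ} (d : Der s φ) : φ ∈ s := by
  by_contra h
  rw [← m.neg_iff] at h
  refine m.con (Der.taut2 _ _ _ (fun v => ?_) (.hyp _ h) d)
  simp only [evalT]
  cases evalT v φ <;> simp
theorem MCS.thm {φ} (d : Prov4 φ) : φ ∈ s := m.der (.prov _ d)
theorem MCS.and_iff (φ ψ) : .and φ ψ ∈ s ↔ φ ∈ s ∧ ψ ∈ s := by
  refine ⟨fun h => ⟨m.der ?_, m.der ?_⟩, fun h => m.der ?_⟩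
  · exact Der.taut1 _ _ (fun v => by simp +contextual [evalT]) (.hyp _ h)
  · exact Der.taut1 _ _ (fun v => by simp +contextual [evalT]) (.hyp _ h)
  · exact Der.taut2 _ _ _ (fun v => by simp +contextual [evalT]) (.hyp _ h.1) (.hyp _ h.2)
theorem MCS.imp_iff (φ ψ) : imp φ ψ ∈ s ↔ (φ ∈ s → ψ ∈ s) := by
  simp [imp, m.neg_iff, m.and_iff]
theorem MCS.or_iff (φ ψ) : orf φ ψ ∈ s ↔ (φ ∈ s ∨ ψ ∈ s) := by
  simp only [orf, m.neg_iff, m.and_iff]; tauto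
theorem MCS.bull_congr (φ ψ) (h : Prov4 (ifff φ ψ)) : .bull φ ∈ s ↔ .bull ψ ∈ s := by
  have := m.thm (.r4 _ _ h)
  simp only [ifff, circ, m.and_iff, m.imp_iff, m.neg_iff] at this
  tauto
theorem MCS.nabla_congr (φ ψ) (h : Prov4 (ifff φ ψ)) : .nabla φ ∈ s ↔ .nabla ψ ∈ s := by
  have := m.thm (.r3 _ _ h)
  simp only [ifff, delta, m.and_iff, m.imp_iff, m.neg_iff] at this
  tauto
theorem MCS.nabla_neg (φ) : .nabla (.neg φ) ∈ s ↔ .nabla φ ∈ s := by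
  have := m.thm (.a2 φ)
  simp only [ifff, m.and_iff, m.imp_iff] at this
  tauto
theorem MCS.b1 {φ} (h : .bull φ ∈ s) : φ ∈ s := (m.imp_iff _ _).1 (m.thm (.a1 φ)) h
theorem MCS.b3 {φ ψ} (h : .bull (imp ψ φ) ∈ s) (h2 : φ ∈ s) : .bull φ ∈ s :=
  (m.imp_iff _ _).1 (m.thm (.a3 φ ψ)) ((m.and_iff _ _).2 ⟨h, h2⟩)
theorem MCS.b4 {φ ψ} (h : .nabla (.and φ ψ) ∈ s) : .nabla φ ∈ s ∨ .nabla ψ ∈ s :=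
  (m.or_iff _ _).1 ((m.imp_iff _ _).1 (m.thm (.a4 φ ψ)) h)
theorem MCS.b5 {φ ψ} (h : .bull (.and φ ψ) ∈ s) : .bull φ ∈ s ∨ .bull ψ ∈ s :=
  (m.or_iff _ _).1 ((m.imp_iff _ _).1 (m.thm (.a5 φ ψ)) h)
theorem MCS.b6 {φ} (h : .nabla φ ∈ s) : .bull φ ∈ s ∨ .bull (.neg φ) ∈ s :=
  (m.or_iff _ _).1 ((m.imp_iff _ _).1 (m.thm (.a6 φ)) h)
theorem MCS.b7 {φ ψ χ} (h : .bull (imp φ ψ) ∈ s) (h2 : .bull (imp (.neg φ) χ) ∈ s) :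
    .nabla φ ∈ s :=
  (m.imp_iff _ _).1 (m.thm (.a7 φ ψ χ)) ((m.and_iff _ _).2 ⟨h, h2⟩)

/-- monotonicity, contrapositive -/
theorem MCS.bmono {φ ψ} (h : Prov4 (imp φ ψ)) (hφ : φ ∈ s) (hb : .bull ψ ∈ s) :
    .bull φ ∈ s := by
  refine m.b3 (ψ := .neg ψ) ((m.bull_congr _ _ ?_).1 hb) hφ
  refine taut1 _ _ (fun v => ?_) h
  simp only [ifff, imp, evalT]
  cases evalT v φ <;> cases evalT v ψ <;> simp
end

/-- the box set relative to a witness -/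
def Box (s : Set Form) (ψ : Form) : Set Form :=
  {χ | .nabla χ ∉ s ∧ .bull (imp (.neg ψ) χ) ∉ s}

theorem box_key {s} (m : MCS s) {ψ χ} (hψ : .bull ψ ∈ s) (h : χ ∈ Box s ψ) (β) :
    .bull (imp (.neg χ) β) ∉ s := by
  intro hb
  refine h.1 (m.b7 (ψ := ψ) ?_ hb)
  have hm := m.b1 hψ
  have h2 : .bull (.and (imp (.neg ψ) χ) (imp χ ψ)) ∈ s := by
    refine m.bmono (ψ := ψ) (.a0 _ (fun v => ?_)) ?_ hψ
    · simp only [imp, evalT]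
      cases evalT v χ <;> cases evalT v ψ <;> simp
    · simp only [m.and_iff, m.imp_iff, m.neg_iff]; tauto
  exact (m.b5 h2).resolve_left h.2

theorem box_indep {s} (m : MCS s) {ψ ψ' χ} (hψ : .bull ψ ∈ s) (h : χ ∈ Box s ψ) :
    χ ∈ Box s ψ' := by
  refine ⟨h.1, fun hb => box_key m hψ h ψ' ((m.bull_congr _ _ (.a0 _ fun v => ?_)).1 hb)⟩
  simp only [ifff, imp, evalT]
  cases evalT v χ <;> cases evalT v ψ' <;> simp

theorem box_mono {s} (m : MCS s) {ψ χ θ} (hψ : .bull ψ ∈ s) (h : χ ∈ Box s ψ)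
    (hp : Prov4 (imp χ θ)) : θ ∈ Box s ψ := by
  have key := box_key m hψ h
  have hχθ : χ ∈ s → θ ∈ s := (m.imp_iff _ _).1 (m.thm hp)
  constructor
  · intro hn
    rcases m.b6 hn with hb | hb
    · refine key θ ((m.bull_congr _ _ ?_).1 hb)
      refine taut1 _ _ (fun v => ?_) hp
      simp only [ifff, imp, evalT]
      cases evalT v χ <;> cases evalT v θ <;> simp
    · have hθ : θ ∉ s := (m.neg_iff _).1 (m.b1 hb)
      have h1 : .nabla (.and (.neg χ) (.neg (.and θ (.neg χ)))) ∈ s := by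
        rw [← m.nabla_neg] at hn
        refine (m.nabla_congr _ _ ?_).1 hn
        refine taut1 _ _ (fun v => ?_) hp
        simp only [ifff, imp, evalT]
        cases evalT v χ <;> cases evalT v θ <;> simp
      rcases m.b4 h1 with h2 | h2
      · exact h.1 ((m.nabla_neg _).1 h2)
      · rw [m.nabla_neg] at h2
        rcases m.b6 h2 with h3 | h3
        · exact hθ ((m.and_iff _ _).1 (m.b1 h3)).1
        · refine key (.neg θ) ((m.bull_congr _ _ (.a0 _ fun v => ?_)).1 h3)
          simp only [ifff, imp, evalT]
          cases evalT v χ <;> cases evalT v θ <;> simp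
  · intro hb
    refine h.2 (m.bmono (taut1 _ _ (fun v => ?_) hp) ?_ hb)
    · simp only [imp, evalT]
      cases evalT v χ <;> cases evalT v θ <;> cases evalT v ψ <;> simp
    · have := m.b1 hψ
      simp only [m.imp_iff, m.neg_iff]; tauto

theorem box_and {s} (m : MCS s) {ψ χ θ} (h : χ ∈ Box s ψ) (h' : θ ∈ Box s ψ) :
    .and χ θ ∈ Box s ψ := by
  constructor
  · intro hn
    exact (m.b4 hn).elim h.1 h'.1
  · intro hb
    refine (m.b5 ((m.bull_congr _ (.and (imp (.neg ψ) χ) (imp (.neg ψ) θ))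
      (.a0 _ fun v => ?_)).1 hb)).elim h.2 h'.2
    simp only [ifff, imp, evalT]
    cases evalT v χ <;> cases evalT v θ <;> cases evalT v ψ <;> simp

theorem box_der {s} (m : MCS s) {ψ χ} (hψ : .bull ψ ∈ s) (d : Der (Box s ψ) χ) :
    χ ∈ Box s ψ := by
  induction d with
  | hyp χ h => exact h
  | prov χ h =>
    refine ⟨(m.neg_iff _).1 (m.thm (.r1 _ h)), (m.neg_iff _).1 (m.thm (.r2 _ ?_))⟩
    refine taut1 _ _ (fun v => ?_) h
    simp +contextual [eval_imp]
  | mp a b _ _ h1 h2 =>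
    refine box_mono m hψ (box_and m h1 h2) (.a0 _ fun v => ?_)
    simp only [imp, evalT]
    cases evalT v a <;> cases evalT v b <;> simp

theorem box_ext {s} (m : MCS s) {ψ χ} (hψ : .bull ψ ∈ s) (h : χ ∉ Box s ψ) :
    ∃ t, Box s ψ ⊆ t ∧ MCS t ∧ χ ∉ t := by
  obtain ⟨t, h1, h2⟩ := lind (insert (.neg χ) (Box s ψ)) (by
    intro d
    refine h (box_der m hψ (Der.taut1 _ _ (fun v => ?_) (ded d)))
    simp only [bot, imp, evalT]
    cases evalT v χ <;> simp)
  exact ⟨t, (Set.subset_insert _ _).trans h1, h2, (h2.neg_iff _).1 (h1 (Set.mem_insert _ _))⟩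

def CM : Model {s : Set Form // MCS s} where
  R s t := ∃ ψ, .bull ψ ∈ s.1 ∧ Box s.1 ψ ⊆ t.1
  V n s := .atom n ∈ s.1

theorem CM_trans (a b c : {s : Set Form // MCS s}) (h : CM.R a b) (h' : CM.R b c) :
    CM.R a c := by
  obtain ⟨ψ, hψ, hab⟩ := h
  obtain ⟨ψ', hψ', hbc⟩ := h'
  refine ⟨ψ, hψ, fun φ hφ => hbc ?_⟩
  have m := a.2
  have h1 := m.thm (.a41 φ)
  have h2 := m.thm (.a42 φ (.neg ψ))
  have h3 := m.thm (.a43 φ ψ ψ')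
  have h4 := m.thm (.a44 φ ψ ψ')
  simp only [ax41, ax42, ax43, ax44, m.imp_iff, m.and_iff, delta, circ, m.neg_iff] at h1 h2 h3 h4
  have hd : .neg (.nabla φ) ∈ b.1 := hab ⟨h1 hφ.1, h2 hφ.1⟩
  have hc : .neg (.bull (imp (.neg ψ') φ)) ∈ b.1 :=
    hab ⟨h3 ⟨hψ, hφ.1, hφ.2⟩, h4 ⟨hψ, hφ.1, hφ.2⟩⟩
  exact ⟨(b.2.neg_iff _).1 hd, (b.2.neg_iff _).1 hc⟩

theorem truth (φ : Form) : ∀ s : {s : Set Form // MCS s}, sat CM s φ ↔ φ ∈ s.1 := by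
  induction φ with
  | atom n => intro s; exact Iff.rfl
  | neg φ ih => intro s; simp only [sat, ih, s.2.neg_iff]
  | and φ ψ ih1 ih2 => intro s; simp only [sat, ih1, ih2, s.2.and_iff]
  | nabla φ ih =>
    intro s
    have m := s.2
    simp only [sat, ih]
    constructor
    · rintro ⟨t, u, ⟨ψ, hψ, hst⟩, ⟨ψ', hψ', hsu⟩, ht, hu⟩
      by_contra hn
      have h1 : .bull (imp (.neg ψ) φ) ∈ s.1 := by
        by_contra hb
        exact hu (hsu (box_indep m hψ ⟨hn, hb⟩))
      have h2 : .bull (imp (.neg ψ) (.neg φ)) ∈ s.1 := by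
        by_contra hb
        exact (t.2.neg_iff _).1 (hst ⟨fun h => hn ((m.nabla_neg _).1 h), hb⟩) ht
      refine hn (m.b7 (ψ := ψ) (χ := ψ) ((m.bull_congr _ _ (.a0 _ fun v => ?_)).1 h2)
        ((m.bull_congr _ _ (.a0 _ fun v => ?_)).1 h1)) <;>
      · simp only [ifff, imp, evalT]
        cases evalT v φ <;> cases evalT v ψ <;> simp
    · intro hn
      obtain ⟨ψ, hψ⟩ : ∃ ψ, .bull ψ ∈ s.1 := (m.b6 hn).elim (fun h => ⟨_, h⟩) (fun h => ⟨_, h⟩)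
      obtain ⟨u, hu, mu, h1⟩ := box_ext m hψ (χ := φ) (fun h => h.1 hn)
      obtain ⟨t, ht, mt, h2⟩ := box_ext m hψ (χ := .neg φ)
        (fun h => h.1 ((m.nabla_neg _).2 hn))
      rw [mt.neg_iff, not_not] at h2
      exact ⟨⟨t, mt⟩, ⟨u, mu⟩, ⟨ψ, hψ, ht⟩, ⟨ψ, hψ, hu⟩, h2, h1⟩
  | bull φ ih =>
    intro s
    have m := s.2
    simp only [sat, ih]
    constructor
    · rintro ⟨hs, t, ⟨ψ, hψ, hst⟩, ht⟩
      by_contra hb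
      refine ht (hst ⟨fun hn => ?_, fun h => hb (m.b3 h hs)⟩)
      exact (m.b6 hn).elim hb (fun h => (m.neg_iff _).1 (m.b1 h) hs)
    · intro hb
      refine ⟨m.b1 hb, ?_⟩
      obtain ⟨u, hu, mu, h1⟩ := box_ext m hb (χ := φ) (fun h => h.2 (by
        refine (m.bull_congr _ _ (.a0 _ fun v => ?_)).1 hb
        simp only [ifff, imp, evalT]
        cases evalT v φ <;> simp))
      exact ⟨⟨u, mu⟩, ⟨φ, hb, hu⟩, h1⟩

theorem eval_bigAnd (v) (L : List Form) :
    evalT v (bigAnd L) = true ↔ ∀ φ ∈ L, evalT v φ = true := by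
  induction L with
  | nil => simp [bigAnd, evalT]
  | cons a L ih =>
    cases L with
    | nil => simp [bigAnd]
    | cons b L => simp [bigAnd, evalT] at ih ⊢; simp [ih]

theorem der_list {Γ : Set Form} (φ₀ : Form) (h0 : φ₀ ∈ Γ) {φ} (d : Der Γ φ) :
    ∃ L : List Form, L ≠ [] ∧ (∀ χ ∈ L, χ ∈ Γ) ∧ Prov4 (imp (bigAnd L) φ) := by
  induction d with
  | hyp χ hχ =>
    exact ⟨[χ], by simp, by simpa using hχ, .a0 _ fun v => by simp [bigAnd, eval_imp]⟩
  | prov χ hχ =>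
    exact ⟨[φ₀], by simp, by simpa using h0,
      taut1 _ _ (fun v => by simp +contextual [eval_imp]) hχ⟩
  | mp a b _ _ h1 h2 =>
    obtain ⟨L, hL, hL1, p⟩ := h1
    obtain ⟨L', hL', hL1', p'⟩ := h2
    refine ⟨L ++ L', by simp [hL], ?_, taut2 _ _ _ (fun v => ?_) p p'⟩
    · intro χ hχ
      rcases List.mem_append.1 hχ with h | h
      · exact hL1 _ h
      · exact hL1' _ h
    · have e1 := eval_bigAnd v L
      have e2 := eval_bigAnd v L'
      have e3 := eval_bigAnd v (L ++ L')
      have e4 : evalT v (bigAnd (L ++ L')) = (evalT v (bigAnd L) && evalT v (bigAnd L')) := by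
        rw [Bool.eq_iff_iff, e3, Bool.and_eq_true, e1, e2]
        simp only [List.mem_append, or_imp, forall_and]
      simp only [eval_imp, e4]
      cases evalT v (bigAnd L) <;> cases evalT v (bigAnd L') <;> cases evalT v a <;>
        cases evalT v b <;> simp

end K4P

theorem stmt15 (Γ : Set Form) (h : Consistent4 Γ) :
    ∃ (W : Type) (_ : Nonempty W) (M : Model W) (s : W),
      (∀ a b c : W, M.R a b → M.R b c → M.R a c) ∧ ∀ φ ∈ Γ, sat M s φ := by
  rcases Γ.eq_empty_or_nonempty with rfl | ⟨φ₀, h0⟩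
  · exact ⟨Unit, ⟨()⟩, ⟨fun _ _ => False, fun _ _ => False⟩, (), fun _ _ _ h => h.elim,
      fun _ h => h.elim⟩
  obtain ⟨t, hΓ, mt⟩ := K4P.lind Γ (by
    intro d
    obtain ⟨L, hL, h1, h2⟩ := K4P.der_list φ₀ h0 d
    refine h ⟨L, hL, h1, K4P.taut1 _ _ (fun v => ?_) h2⟩
    simp only [K4P.eval_imp, K4P.bot, evalT]
    cases evalT v (bigAnd L) <;> simp)
  exact ⟨_, ⟨⟨t, mt⟩⟩, K4P.CM, ⟨t, mt⟩, K4P.CM_trans, fun φ hφ => (K4P.truth φ _).2 (hΓ hφ)⟩
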